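/- Let T > 0, θ ∈ (0,1], ℓ > 0, ν ∈ [0,1), set μ := θ(ℓ+1), and let E, F be real Banach spaces. Let k : (0,T] × (0,T] × E → F be continuous with k(t,s,0) = 0 for all (t,s) ∈ (0,T]², and suppose there is a non-negative measurable function h on (0,T]² such that ‖k(t,s,v) − k(t,s,w)‖_F ≤ h(t,s)(‖v‖_E^ℓ + ‖w‖_E^ℓ)‖v − w‖_E for all (t,s) ∈ (0,T]² and v, w ∈ E, such that H(t) := ∫₀ᵀ h(t,s) s^{−μ} ds is finite for every t ∈ (0,T] and t^ν H(t) → 0 as t → 0⁺ with C_h := sup_{t∈(0,T]} t^ν H(t) < ∞. Then for every v ∈ C_θ((0,T],E) and every t ∈ (0,T] the function s ↦ k(t,s,v(s)) is Bochner integrable on (0,T], and writing f(v)(t) := ∫₀ᵀ k(t,s,v(s)) ds one has, for all v, w ∈ C_θ((0,T],E) and all t ∈ (0,T]: ‖f(v)(t) − f(w)(t)‖_F ≤ H(t)(‖v‖_{C_θ((0,T],E)}^ℓ + ‖w‖_{C_θ((0,T],E)}^ℓ)‖v − w‖_{C_θ((0,T],E)}; consequently sup_{t∈(0,T]} t^ν‖f(v)(t)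 − f(w)(t)‖_F ≤ C_h(‖v‖_{C_θ((0,T],E)}^ℓ + ‖w‖_{C_θ((0,T],E)}^ℓ)‖v − w‖_{C_θ((0,T],E)} and t^ν‖f(v)(t)‖_F → 0 as t → 0⁺. -/

import Mathlib

open MeasureTheory

/-- `u` belongs to the time-weighted space `C_θ((0,T],E)`: it is continuous on `(0,T]`
and `t^θ‖u(t)‖ → 0` as `t → 0⁺`. -/
def memC {E : Type*} [NormedAddCommGroup E] (θ T : ℝ) (u : ℝ → E) : Prop :=
  ContinuousOn u (Set.Ioc 0 T) ∧
    Filter.Tendsto (fun t => t ^ θ * ‖u t‖) (nhdsWithin 0 (Set.Ioi 0)) (nhds 0)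

/-- The norm of the time-weighted space `C_θ((0,T],E)`:
`‖u‖ = sup_{t ∈ (0,T]} t^θ‖u(t)‖`. -/
noncomputable def wnorm {E : Type*} [NormedAddCommGroup E] (θ T : ℝ) (u : ℝ → E) : ℝ :=
  sSup ((fun t => t ^ θ * ‖u t‖) '' Set.Ioc 0 T)

open Set Filter Topology

section WeightedSpace

variable {E : Type*} [NormedAddCommGroup E] {θ T : ℝ} {u v : ℝ → E}

theorem memC.bddAbove (hu : memC θ T u) :
    BddAbove ((fun t => t ^ θ * ‖u t‖) '' Ioc 0 T) := by
  obtain ⟨hc, h0⟩ := hu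
  obtain ⟨δ, hδ, hδ1⟩ := mem_nhdsGT_iff_exists_Ioo_subset.1 (h0.eventually_lt_const one_pos)
  have hsub : Icc δ T ⊆ Ioc 0 T := fun t ht => ⟨lt_of_lt_of_le hδ ht.1, ht.2⟩
  have hcont : ContinuousOn (fun t => t ^ θ * ‖u t‖) (Icc δ T) :=
    (continuousOn_id.rpow_const fun t ht => Or.inl (hsub ht).1.ne').mul (hc.mono hsub).norm
  refine ((isCompact_Icc.image_of_continuousOn hcont).bddAbove.union
    (bddAbove_Iic (a := (1 : ℝ)))).mono ?_
  rintro _ ⟨t, ht, rfl⟩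
  rcases lt_or_ge t δ with h | h
  · exact Or.inr (show t ^ θ * ‖u t‖ < 1 from hδ1 ⟨ht.1, h⟩).le
  · exact Or.inl ⟨t, ⟨h, ht.2⟩, rfl⟩

theorem wnorm_nonneg (θ T : ℝ) (u : ℝ → E) : 0 ≤ wnorm θ T u := by
  refine Real.sSup_nonneg ?_
  rintro _ ⟨t, ht, rfl⟩
  exact mul_nonneg (Real.rpow_nonneg ht.1.le _) (norm_nonneg _)

theorem memC.norm_le (hu : memC θ T u) {t : ℝ} (ht : t ∈ Ioc 0 T) :
    ‖u t‖ ≤ wnorm θ T u * t ^ (-θ) := by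
  rw [Real.rpow_neg ht.1.le, ← div_eq_mul_inv, le_div_iff₀ (Real.rpow_pos_of_pos ht.1 _), mul_comm]
  exact le_csSup hu.bddAbove ⟨t, ht, rfl⟩

theorem memC.sub (hT : 0 < T) (hu : memC θ T u) (hv : memC θ T v) :
    memC θ T fun t => u t - v t := by
  refine ⟨hu.1.sub hv.1, squeeze_zero' ?_ ?_ (by simpa using hu.2.add hv.2)⟩
  all_goals filter_upwards [Ioc_mem_nhdsGT hT] with t ht
  all_goals have := Real.rpow_nonneg ht.1.le θ
  · positivity
  · rw [← mul_add]
    exact mul_le_mul_of_nonneg_left (norm_sub_le _ _) this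

theorem memC_zero (θ T : ℝ) : memC θ T fun _ => (0 : E) :=
  ⟨continuousOn_const, by simp⟩

theorem wnorm_zero (hT : 0 < T) : wnorm θ T (fun _ => (0 : E)) = 0 := by
  simp [wnorm, (nonempty_Ioc.2 hT).image_const]

/-- The local Lipschitz bound for a kernel, evaluated along two functions of the weighted space. -/
theorem memC.lipschitz_bound (hT : 0 < T) (hu : memC θ T u) (hv : memC θ T v)
    {ℓ : ℝ} (hℓ : 0 < ℓ) {s : ℝ} (hs : s ∈ Ioc 0 T) {c : ℝ} (hc : 0 ≤ c) :
    c * (‖u s‖ ^ ℓ + ‖v s‖ ^ ℓ) * ‖u s - v s‖ ≤ c * s ^ (-(θ * (ℓ + 1))) *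
      ((wnorm θ T u ^ ℓ + wnorm θ T v ^ ℓ) * wnorm θ T (fun s => u s - v s)) := by
  have hpow {w : ℝ → E} (hw : memC θ T w) : ‖w s‖ ^ ℓ ≤ wnorm θ T w ^ ℓ * s ^ (-θ * ℓ) := by
    rw [Real.rpow_mul hs.1.le,
      ← Real.mul_rpow (wnorm_nonneg _ _ _) (Real.rpow_nonneg hs.1.le _)]
    exact Real.rpow_le_rpow (norm_nonneg _) (hw.norm_le hs) hℓ.le
  have hsplit : s ^ (-(θ * (ℓ + 1))) = s ^ (-θ * ℓ) * s ^ (-θ) := by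
    rw [← Real.rpow_add hs.1]
    ring_nf
  have hsum := add_le_add (hpow hu) (hpow hv)
  calc c * (‖u s‖ ^ ℓ + ‖v s‖ ^ ℓ) * ‖u s - v s‖
      ≤ c * (wnorm θ T u ^ ℓ * s ^ (-θ * ℓ) + wnorm θ T v ^ ℓ * s ^ (-θ * ℓ)) *
          (wnorm θ T (fun s => u s - v s) * s ^ (-θ)) :=
        mul_le_mul (mul_le_mul_of_nonneg_left hsum hc) ((hu.sub hT hv).norm_le hs)
          (norm_nonneg _) (mul_nonneg hc ((by positivity : (0 : ℝ) ≤ _).trans hsum))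
    _ = _ := by rw [hsplit]; ring

end WeightedSpace

/-- The nonlocal-in-time nonlinearity `f(v)(t) = ∫₀ᵀ k(t,s,v(s)) ds` with a kernel
satisfying `‖k(t,s,v) − k(t,s,w)‖ ≤ h(t,s)(‖v‖^ℓ + ‖w‖^ℓ)‖v − w‖`, where
`H(t) = ∫₀ᵀ h(t,s)s^{−μ} ds` (with `μ = θ(ℓ+1)`) is finite and `t^ν H(t) → 0` with
finite sup `C_h`: then `s ↦ k(t,s,v(s))` is Bochner integrable, and `f` satisfies the
Lipschitz estimate of condition (A2). -/
theorem stmt_2 {E F : Type*} [NormedAddCommGroup E] [NormedSpace ℝ E]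
    [NormedAddCommGroup F] [NormedSpace ℝ F] [CompleteSpace F]
    (T θ ℓ ν : ℝ) (hT : 0 < T) (hθ : 0 < θ) (hθ1 : θ ≤ 1) (hℓ : 0 < ℓ)
    (hν0 : 0 ≤ ν) (hν1 : ν < 1)
    (k : ℝ → ℝ → E → F)
    (hk : ContinuousOn (fun p : ℝ × ℝ × E => k p.1 p.2.1 p.2.2)
      (Set.Ioc 0 T ×ˢ Set.Ioc 0 T ×ˢ Set.univ))
    (hk0 : ∀ t ∈ Set.Ioc (0:ℝ) T, ∀ s ∈ Set.Ioc (0:ℝ) T, k t s 0 = 0)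
    (h : ℝ → ℝ → ℝ)
    (hh0 : ∀ t ∈ Set.Ioc (0:ℝ) T, ∀ s ∈ Set.Ioc (0:ℝ) T, 0 ≤ h t s)
    (hhm : AEMeasurable (fun p : ℝ × ℝ => h p.1 p.2)
      ((volume.restrict (Set.Ioc 0 T)).prod (volume.restrict (Set.Ioc 0 T))))
    (hklip : ∀ t ∈ Set.Ioc (0:ℝ) T, ∀ s ∈ Set.Ioc (0:ℝ) T, ∀ v w : E,
      ‖k t s v - k t s w‖ ≤ h t s * (‖v‖ ^ ℓ + ‖w‖ ^ ℓ) * ‖v - w‖)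
    (hH : ∀ t ∈ Set.Ioc (0:ℝ) T,
      IntegrableOn (fun s => h t s * s ^ (-(θ * (ℓ + 1)))) (Set.Ioc 0 T))
    (hH0 : Filter.Tendsto
      (fun t => t ^ ν * ∫ s in Set.Ioc (0:ℝ) T, h t s * s ^ (-(θ * (ℓ + 1))))
      (nhdsWithin 0 (Set.Ioi 0)) (nhds 0))
    (hCh : BddAbove
      ((fun t => t ^ ν * ∫ s in Set.Ioc (0:ℝ) T, h t s * s ^ (-(θ * (ℓ + 1)))) ''
        Set.Ioc 0 T)) :
    (∀ v : ℝ → E, memC θ T v →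
      ∀ t ∈ Set.Ioc (0:ℝ) T, IntegrableOn (fun s => k t s (v s)) (Set.Ioc 0 T)) ∧
    (∀ v w : ℝ → E, memC θ T v → memC θ T w →
      (∀ t ∈ Set.Ioc (0:ℝ) T,
        ‖(∫ s in Set.Ioc (0:ℝ) T, k t s (v s)) - ∫ s in Set.Ioc (0:ℝ) T, k t s (w s)‖ ≤
          (∫ s in Set.Ioc (0:ℝ) T, h t s * s ^ (-(θ * (ℓ + 1)))) *
            ((wnorm θ T v ^ ℓ + wnorm θ T w ^ ℓ) * wnorm θ T (fun s => v s - w s))) ∧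
      (∀ t ∈ Set.Ioc (0:ℝ) T,
        t ^ ν * ‖(∫ s in Set.Ioc (0:ℝ) T, k t s (v s)) -
            ∫ s in Set.Ioc (0:ℝ) T, k t s (w s)‖ ≤
          sSup ((fun t => t ^ ν *
              ∫ s in Set.Ioc (0:ℝ) T, h t s * s ^ (-(θ * (ℓ + 1)))) '' Set.Ioc 0 T) *
            ((wnorm θ T v ^ ℓ + wnorm θ T w ^ ℓ) * wnorm θ T (fun s => v s - w s)))) ∧
    (∀ v : ℝ → E, memC θ T v →
      Filter.Tendsto (fun t => t ^ ν * ‖∫ s in Set.Ioc (0:ℝ) T, k t s (v s)‖)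
        (nhdsWithin 0 (Set.Ioi 0)) (nhds 0)) := by
  have hbound : ∀ v w : ℝ → E, memC θ T v → memC θ T w → ∀ t ∈ Ioc 0 T, ∀ s ∈ Ioc 0 T,
      ‖k t s (v s) - k t s (w s)‖ ≤ h t s * s ^ (-(θ * (ℓ + 1))) *
        ((wnorm θ T v ^ ℓ + wnorm θ T w ^ ℓ) * wnorm θ T (fun s => v s - w s)) :=
    fun v w hv hw t ht s hs => (hklip t ht s hs _ _).trans
      (hv.lipschitz_bound hT hw hℓ hs (hh0 t ht s hs))
  have hint : ∀ v : ℝ → E, memC θ T v →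
      ∀ t ∈ Ioc (0:ℝ) T, IntegrableOn (fun s => k t s (v s)) (Ioc 0 T) := by
    intro v hv t ht
    have hcont : ContinuousOn (fun s => k t s (v s)) (Ioc 0 T) :=
      hk.comp (f := fun s => (t, s, v s))
        (continuousOn_const.prodMk (continuousOn_id.prodMk hv.1))
        fun s hs => ⟨ht, hs, mem_univ _⟩
    refine ((hH t ht).mul_const (wnorm θ T v ^ ℓ * wnorm θ T v)).mono'
      (hcont.aestronglyMeasurable measurableSet_Ioc)
      (ae_restrict_of_forall_mem measurableSet_Ioc fun s hs => ?_)
    simpa [hk0 t ht s hs, wnorm_zero hT, Real.zero_rpow hℓ.ne'] using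
      hbound v (fun _ => 0) hv (memC_zero θ T) t ht s hs
  have hdiff : ∀ v w : ℝ → E, memC θ T v → memC θ T w → ∀ t ∈ Ioc (0:ℝ) T,
      ‖(∫ s in Ioc (0:ℝ) T, k t s (v s)) - ∫ s in Ioc (0:ℝ) T, k t s (w s)‖ ≤
        (∫ s in Ioc (0:ℝ) T, h t s * s ^ (-(θ * (ℓ + 1)))) *
          ((wnorm θ T v ^ ℓ + wnorm θ T w ^ ℓ) * wnorm θ T (fun s => v s - w s)) := by
    intro v w hv hw t ht
    rw [← integral_sub (hint v hv t ht) (hint w hw t ht), ← integral_mul_const]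
    exact norm_integral_le_of_norm_le ((hH t ht).mul_const _)
      (ae_restrict_of_forall_mem measurableSet_Ioc (hbound v w hv hw t ht))
  refine ⟨hint, fun v w hv hw => ⟨hdiff v w hv hw, fun t ht => ?_⟩, fun v hv => ?_⟩
  · have hv0 := wnorm_nonneg θ T v
    have hw0 := wnorm_nonneg θ T w
    have hvw0 := wnorm_nonneg θ T fun s => v s - w s
    refine (mul_le_mul_of_nonneg_left (hdiff v w hv hw t ht)
      (Real.rpow_nonneg ht.1.le ν)).trans ?_
    rw [← mul_assoc]
    exact mul_le_mul_of_nonneg_right (le_csSup hCh ⟨t, ht, rfl⟩) (by positivity)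
  · refine squeeze_zero' ?_ ?_ (by simpa using hH0.mul_const (wnorm θ T v ^ ℓ * wnorm θ T v))
    all_goals filter_upwards [Ioc_mem_nhdsGT hT] with t ht
    all_goals have hpos := Real.rpow_nonneg ht.1.le ν
    · positivity
    · have hzero : ∫ s in Ioc (0:ℝ) T, k t s 0 = 0 :=
        setIntegral_eq_zero_of_forall_eq_zero (hk0 t ht)
      have hle := hdiff v (fun _ => 0) hv (memC_zero θ T) t ht
      simp only [hzero, sub_zero, wnorm_zero hT, Real.zero_rpow hℓ.ne', add_zero] at hle
      rw [mul_assoc]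
      exact mul_le_mul_of_nonneg_left hle hpos
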